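/- Let M ∈ ℂ^{n×n} and let λ ∈ ℂ be a simple eigenvalue of M, i.e. λ is a root of the characteristic polynomial of M of multiplicity exactly one. If x, y ∈ ℂⁿ are nonzero vectors with x* M = λ x* (x is a left eigenvector) and M y = λ y (y is a right eigenvector), then x* y ≠ 0. -/

import Mathlib

open Matrix Polynomial

/-- If `μ` is a simple root of the characteristic polynomial of `f`, a linear functional that
vanishes on an eigenvector of `f` for `μ` and satisfies `φ ∘ f = μ • φ` is zero. -/
theorem Module.Dual.eq_zero_of_comp_eq_smul_of_apply_eq_zero {K V : Type*} [Field K]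
    [AddCommGroup V] [Module K V] [FiniteDimensional K V] (f : Module.End K V) (μ : K)
    (hsimple : f.charpoly.rootMultiplicity μ = 1) {φ : Module.Dual K V}
    (hφ : ∀ v, φ (f v) = μ * φ v) {y : V} (hy : y ≠ 0) (hfy : f y = μ • y) (hφy : φ y = 0) :
    φ = 0 := by
  have hspan : ∀ v ∈ f.maxGenEigenspace μ, ∃ c : K, c • y = v := by
    intro v hv
    have hymem : y ∈ f.maxGenEigenspace μ :=
      f.mem_maxGenEigenspace μ y |>.2 ⟨1, by simp [hfy]⟩
    have h1 : Module.finrank K (f.maxGenEigenspace μ) = 1 := by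
      rw [f.finrank_maxGenEigenspace_eq, hsimple]
    obtain ⟨c, hc⟩ := exists_smul_eq_of_finrank_eq_one h1
      (x := ⟨y, hymem⟩) (by simpa [Subtype.ext_iff] using hy) ⟨v, hv⟩
    exact ⟨c, congrArg Subtype.val hc⟩
  set g : Module.End K V := f - μ • 1 with hg
  have hgy : g y = 0 := by simp [hg, hfy]
  have hdisj : Disjoint (LinearMap.range g) (LinearMap.ker g) := by
    rw [Submodule.disjoint_def]
    rintro _ ⟨u, rfl⟩ hu
    obtain ⟨c, rfl⟩ := hspan u <|
      f.mem_maxGenEigenspace μ u |>.2 ⟨2, by simpa [pow_two, hg] using hu⟩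
    simp [hgy]
  have htop := Submodule.eq_top_of_disjoint _ _ g.finrank_range_add_finrank_ker.ge hdisj
  ext v
  obtain ⟨_, ⟨u, rfl⟩, w, hw, rfl⟩ := Submodule.mem_sup.1 (htop ▸ Submodule.mem_top (x := v))
  obtain ⟨c, rfl⟩ := hspan w <|
    f.mem_maxGenEigenspace μ w |>.2 ⟨1, by simpa [hg] using hw⟩
  simp [hg, hφ, hφy]

/-- If `μ` is a simple eigenvalue of `M` (a root of the characteristic polynomial of
multiplicity exactly one), and `x`, `y` are nonzero left and right eigenvectors of `M`
for `μ`, then `x* y ≠ 0`. -/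
theorem left_right_eigenvector_not_orthogonal_of_simple
    {n : ℕ} (M : Matrix (Fin n) (Fin n) ℂ) (μ : ℂ)
    (hsimple : (Matrix.charpoly M).rootMultiplicity μ = 1)
    (x y : Fin n → ℂ) (hx : x ≠ 0) (hy : y ≠ 0)
    (hleft : Matrix.vecMul (star x) M = μ • star x)
    (hright : M.mulVec y = μ • y) :
    star x ⬝ᵥ y ≠ 0 := by
  intro hxy
  have hzero := Module.Dual.eq_zero_of_comp_eq_smul_of_apply_eq_zero M.mulVecLin μ
    (by rwa [Matrix.charpoly_mulVecLin]) (φ := dotProductBilin ℂ ℂ (star x))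
    (fun v => by
      simp [dotProduct_mulVec, hleft])
    hy (by simpa using hright) (by simpa using hxy)
  exact hx <| star_eq_zero.1 <| dotProduct_eq_zero _ fun v => by
    simpa using LinearMap.congr_fun hzero v
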